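/- For all real a, b, c with 0 ≤ c ≤ b ≤ a ≤ 1/2, the point w = (1 − (a + 2c(1−c))/(3−2a), 1 − (b+c)(1−c)/(2−b+c), 1−c) in ℝ³ is equidistant from the four points p_U = (a, b, 3−c), p_BD = (a, 2+c, −1+b), p_D = (a, b, −1−c), p_R = (3−a, b, c). -/

import Mathlib

/-- The point (x, y, z) of Euclidean 3-space. -/
noncomputable def pt3 (x y z : ℝ) : EuclideanSpace ℝ (Fin 3) :=
  (WithLp.equiv 2 (Fin 3 → ℝ)).symm ![x, y, z]

/-- A point `w` is equidistant from four points. -/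
def Equidist4 (w p q r s : EuclideanSpace ℝ (Fin 3)) : Prop :=
  dist w p = dist w q ∧ dist w q = dist w r ∧ dist w r = dist w s

theorem dist_pt3 (x y z x' y' z' : ℝ) :
    dist (pt3 x y z) (pt3 x' y' z') =
      Real.sqrt ((x - x') ^ 2 + (y - y') ^ 2 + (z - z') ^ 2) := by
  simp [pt3, EuclideanSpace.dist_eq, Fin.sum_univ_three, Real.dist_eq, sq_abs]

/-- The circumcenter c(BD,D,R) of the tetrahedron (p_U, p_BD, p_D, p_R). -/
theorem circumcenter_BD_D_R (a b c : ℝ) (hc : 0 ≤ c) (hcb : c ≤ b) (hba : b ≤ a)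
    (ha : a ≤ 1 / 2) :
    Equidist4
      (pt3 (1 - (a + 2 * c * (1 - c)) / (3 - 2 * a))
        (1 - (b + c) * (1 - c) / (2 - b + c)) (1 - c))
      (pt3 a b (3 - c)) (pt3 a (2 + c) (-1 + b)) (pt3 a b (-1 - c))
      (pt3 (3 - a) b c) := by
  have ha' : 3 - 2 * a ≠ 0 := by linarith
  have hb' : 2 - b + c ≠ 0 := by linarith
  have hx : (a + 2 * c * (1 - c)) / (3 - 2 * a) * (3 - 2 * a) = a + 2 * c * (1 - c) :=
    div_mul_cancel₀ _ ha'
  have hy : (b + c) * (1 - c) / (2 - b + c) * (2 - b + c) = (b + c) * (1 - c) :=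
    div_mul_cancel₀ _ hb'
  generalize (a + 2 * c * (1 - c)) / (3 - 2 * a) = u at hx ⊢
  generalize (b + c) * (1 - c) / (2 - b + c) = v at hy ⊢
  simp only [Equidist4, dist_pt3]
  refine ⟨?_, ?_, ?_⟩ <;> congr 1
  · linear_combination -2 * hy
  · linear_combination 2 * hy
  · linear_combination -2 * hx
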